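/- Abstract error estimate for non-conforming stabilized Galerkin methods: Let H be a real inner product space, D ⊆ H a linear subspace (the discrete space), W ⊆ D a linear subspace (the test space), and S ⊆ D a subset (the consistency space). Let a_h be a symmetric bilinear form on H and let α_*, α^* be real constants with 0 < α_* ≤ α^*, such that (stability) α_*‖v‖² ≤ a_h(v,v) ≤ α^*‖v‖² for all v ∈ D, and (consistency) a_h(q,v) = ⟨q,v⟩ for all q ∈ S and all v ∈ D. Let u ∈ H and suppose u_I, u_n ∈ D satisfy: u_n − u_I ∈ W; a_h(u_n, v) = 0 for all v ∈ W (the discrete problem); and ‖u − u_I‖ ≤ 2‖u − q‖ for all q ∈ S (the interpolation estimate). Finally, let N ≥ 0 be a constant with ⟨u, v⟩ ≤ N‖v‖ for all v ∈ W (bound on the non-conformity functional). Then for every q ∈ S, ‖u − u_n‖ ≤ (α^*/α_*) · (6‖u − q‖ + N). -/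

import Mathlib

open scoped RealInnerProductSpace

/-- A symmetric bilinear form that is nonnegative on a subspace `D` and bounded on the diagonal of
`D` by `C * ‖v‖ ^ 2` is bounded on `D` with the same constant. -/
theorem bilin_le_mul_norm_mul_norm_of_diag
    {H : Type*} [NormedAddCommGroup H] [InnerProductSpace ℝ H] (D : Submodule ℝ H)
    (a : H →ₗ[ℝ] H →ₗ[ℝ] ℝ) (hsymm : ∀ u v : H, a u v = a v u) {C : ℝ} (hC : 0 ≤ C)
    (hnonneg : ∀ v ∈ D, 0 ≤ a v v) (hup : ∀ v ∈ D, a v v ≤ C * ‖v‖ ^ 2)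
    {x y : H} (hx : x ∈ D) (hy : y ∈ D) : a x y ≤ C * ‖x‖ * ‖y‖ := by
  have hcs : a x y * a y x ≤ a x x * a y y :=
    LinearMap.BilinForm.apply_mul_apply_le_of_forall_zero_le (a.domRestrict₁₂ D D)
      (fun v => hnonneg v v.2) ⟨x, hx⟩ ⟨y, hy⟩
  rw [hsymm y x] at hcs
  refine abs_le_of_sq_le_sq' ?_ (by positivity) |>.2
  calc a x y ^ 2 ≤ a x x * a y y := by rw [sq]; exact hcs
    _ ≤ (C * ‖x‖ ^ 2) * (C * ‖y‖ ^ 2) :=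
        mul_le_mul (hup x hx) (hup y hy) (hnonneg y hy) (by positivity)
    _ = (C * ‖x‖ * ‖y‖) ^ 2 := by ring

/-- Abstract error estimate for non-conforming stabilized Galerkin methods. -/
theorem abstract_error_estimate
    {H : Type*} [NormedAddCommGroup H] [InnerProductSpace ℝ H]
    (D W : Submodule ℝ H) (hWD : W ≤ D) (S : Set H) (hSD : S ⊆ (D : Set H))
    (a : H →ₗ[ℝ] H →ₗ[ℝ] ℝ) (hsymm : ∀ u v : H, a u v = a v u)
    (αs αS : ℝ) (hαs : 0 < αs) (hαsS : αs ≤ αS)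
    (hstab_low : ∀ v ∈ D, αs * ‖v‖ ^ 2 ≤ a v v)
    (hstab_up : ∀ v ∈ D, a v v ≤ αS * ‖v‖ ^ 2)
    (hcons : ∀ q ∈ S, ∀ v ∈ D, a q v = ⟪q, v⟫)
    (u uI un : H) (huI : uI ∈ D) (hun : un ∈ D)
    (hdiff : un - uI ∈ W)
    (hdisc : ∀ v ∈ W, a un v = 0)
    (hinterp : ∀ q ∈ S, ‖u - uI‖ ≤ 2 * ‖u - q‖)
    (N : ℝ) (hN : 0 ≤ N)
    (hnc : ∀ v ∈ W, ⟪u, v⟫ ≤ N * ‖v‖) :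
    ∀ q ∈ S, ‖u - un‖ ≤ (αS / αs) * (6 * ‖u - q‖ + N) := by
  intro q hq
  have hqD : q ∈ D := hSD hq
  have hαS : 0 < αS := hαs.trans_le hαsS
  have hnonneg : ∀ v ∈ D, 0 ≤ a v v := fun v hv =>
    le_trans (by positivity) (hstab_low v hv)
  have he := norm_nonneg (u - q)
  have hinterp_q := hinterp q hq
  have htri : ‖u - un‖ ≤ ‖u - uI‖ + ‖un - uI‖ := by
    rw [norm_sub_rev un uI]
    exact norm_sub_le_norm_sub_add_norm_sub u uI un
  have hdist : ‖q - uI‖ ≤ 3 * ‖u - q‖ := by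
    have h := norm_sub_le_norm_sub_add_norm_sub q u uI
    rw [norm_sub_rev q u] at h
    linarith
  have hdD : un - uI ∈ D := hWD hdiff
  set d := un - uI
  have hlow := hstab_low d hdD
  have hadd : a d d = a (q - uI) d - ⟪q, d⟫ := by
    have hdisc_d : a d d = a un d - a uI d := LinearMap.map_sub₂ a un uI d
    rw [hdisc_d, hdisc d hdiff, LinearMap.map_sub₂, hcons q hq d hdD]
    ring
  have hcont : a (q - uI) d ≤ αS * (3 * ‖u - q‖) * ‖d‖ :=
    (bilin_le_mul_norm_mul_norm_of_diag D a hsymm hαS.le hnonneg hstab_up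
      (D.sub_mem hqD huI) hdD).trans (by gcongr)
  -- On a nonzero `q`, stability and consistency force `1 ≤ αS`; `q = 0` has no consistency error.
  have hbound : -⟪q, d⟫ ≤ αS * (‖u - q‖ + N) * ‖d‖ := by
    rcases eq_or_ne q 0 with rfl | hq0
    · rw [inner_zero_left, neg_zero]
      positivity
    · have hαS_one : 1 ≤ αS := by
        have h := hstab_up q hqD
        rw [hcons q hq q hqD, real_inner_self_eq_norm_sq] at h
        have hpos : 0 < ‖q‖ ^ 2 := by positivity
        exact le_of_mul_le_mul_right (by linarith) hpos
      have hN_d := hnc (-d) (W.neg_mem hdiff)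
      rw [inner_neg_right, norm_neg] at hN_d
      have hcs := real_inner_le_norm (u - q) d
      rw [inner_sub_left] at hcs
      have hnn : 0 ≤ (‖u - q‖ + N) * ‖d‖ := by positivity
      nlinarith [mul_le_mul_of_nonneg_right hαS_one hnn]
  have hd_le : αs * ‖d‖ ≤ αS * (4 * ‖u - q‖ + N) := by
    rcases (norm_nonneg d).eq_or_lt with h0 | hpos
    · rw [← h0, mul_zero]
      positivity
    · refine le_of_mul_le_mul_right ?_ hpos
      nlinarith
  rw [div_mul_eq_mul_div, le_div_iff₀ hαs]
  nlinarith [mul_le_mul_of_nonneg_right hαsS he,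
    mul_le_mul_of_nonneg_left (htri.trans (add_le_add_left hinterp_q _)) hαs.le]
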